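/- arXiv:2202.02439 — 3 statements merged into one kernel-verified Lean document; each statement's English description precedes it below -/
import Mathlib

section
/- Let V be a finite set of n ≥ 2 vertices and w : V × V → ℝ a symmetric nonnegative weight function. Suppose D > 0 is such that every pair of vertices i, j is joined by a path i = v₀, v₁, …, v_r = j along which all consecutive weights w(v_s, v_{s+1}) are positive and Σ_{s=0}^{r−1} 1/w(v_s, v_{s+1}) ≤ D (a bound on the weighted diameter). Then for every z : V → ℝ with Σ_{i ∈ V} z_i = 0, (1/2) Σ_{i,j ∈ V} w(i,j)(z_i − z_j)² ≥ (1/(nD)) · Σ_{i ∈ V} z_i². (The algebraic connectivity satisfies λ₂ ≥ 1/(n d_w), where d_w is the weighted diameter.) -/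
open Finset Real

/-- A finite sequence whose consecutive distinct terms are adjacent yields a walk, of cost at most
the total cost of the steps of the sequence. -/
theorem SimpleGraph.exists_walk_sum_darts_le {V : Type*} (G : SimpleGraph V)
    (f : V → V → ℝ) (hf : ∀ i j, 0 ≤ f i j) (r : ℕ) (p : Fin (r + 1) → V)
    (hp : ∀ s : Fin r, p s.castSucc ≠ p s.succ → G.Adj (p s.castSucc) (p s.succ)) :
    ∃ W : G.Walk (p 0) (p (Fin.last r)),
      (W.darts.map fun d => f d.fst d.snd).sum ≤ ∑ s : Fin r, f (p s.castSucc) (p s.succ) := by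
  induction r with
  | zero => exact ⟨.nil, by simp⟩
  | succ r ih =>
    obtain ⟨W, hW⟩ := ih (fun s => p s.succ) fun s hs => hp s.succ hs
    rw [Fin.sum_univ_succ, ← Fin.succ_last]
    by_cases h : p 0 = p (Fin.succ 0)
    · refine ⟨W.copy h.symm rfl, ?_⟩
      rw [SimpleGraph.Walk.darts_copy]
      exact hW.trans (le_add_of_nonneg_left (hf _ _))
    · have hadj : G.Adj (p 0) (p (Fin.succ 0)) := hp 0 h
      refine ⟨.cons hadj W, ?_⟩
      rw [SimpleGraph.Walk.darts_cons, List.map_cons, List.sum_cons]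
      exact add_le_add_right hW _

/-- The increments of a function along the darts of a walk telescope. -/
theorem SimpleGraph.Walk.sum_darts_sub {V : Type*} {G : SimpleGraph V} (z : V → ℝ) {u v : V}
    (W : G.Walk u v) : (W.darts.map fun d => z d.snd - z d.fst).sum = z v - z u := by
  induction W with
  | nil => simp
  | cons h W ih => simp [ih]

/-- If every step of a walk has positive weight, then the squared difference of `z` between its
endpoints is at most the sum of the reciprocal weights times the full quadratic form. -/
theorem SimpleGraph.Walk.sq_sub_le_sum_darts_mul {V : Type*} [Fintype V] {G : SimpleGraph V}
    (w : V → V → ℝ) (hnn : ∀ i j, 0 ≤ w i j) (hG : ∀ i j, G.Adj i j → 0 < w i j)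
    (z : V → ℝ) {u v : V} (W : G.Walk u v) :
    (z v - z u) ^ 2 ≤ (W.darts.map fun d => 1 / w d.fst d.snd).sum *
      ∑ i, ∑ j, w i j * (z i - z j) ^ 2 := by
  classical
  have hnodup : W.bypass.darts.Nodup :=
    List.Nodup.of_map _ W.bypass_isPath.isTrail.edges_nodup
  have hinv : ∀ d : G.Dart, 0 ≤ 1 / w d.fst d.snd := fun d => one_div_nonneg.2 (hnn _ _)
  have hcost : ∑ d ∈ W.bypass.darts.toFinset, 1 / w d.fst d.snd ≤
      (W.darts.map fun d => 1 / w d.fst d.snd).sum := by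
    rw [List.sum_toFinset _ hnodup]
    obtain ⟨l, hperm, hsub⟩ := hnodup.subperm W.darts_bypass_subset_darts
    rw [← (hperm.map _).sum_eq]
    refine (hsub.map _).sum_le_sum fun x hx => ?_
    obtain ⟨d, -, rfl⟩ := List.mem_map.1 hx
    exact hinv d
  have henergy : ∑ d ∈ W.bypass.darts.toFinset, w d.fst d.snd * (z d.snd - z d.fst) ^ 2 ≤
      ∑ i, ∑ j, w i j * (z i - z j) ^ 2 := by
    rw [← Fintype.sum_prod_type' fun i j => w i j * (z i - z j) ^ 2,
      ← Finset.sum_image (s := W.bypass.darts.toFinset) (g := SimpleGraph.Dart.toProd)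
        (f := fun x => w x.1 x.2 * (z x.2 - z x.1) ^ 2)
        SimpleGraph.Dart.toProd_injective.injOn]
    simp_rw [sub_sq_comm (z (Prod.snd _))]
    exact Finset.sum_le_univ_sum_of_nonneg fun x => mul_nonneg (hnn _ _) (sq_nonneg _)
  rw [← W.bypass.sum_darts_sub z, ← List.sum_toFinset _ hnodup]
  calc _ ≤ (∑ d ∈ W.bypass.darts.toFinset, 1 / w d.fst d.snd) *
        ∑ d ∈ W.bypass.darts.toFinset, w d.fst d.snd * (z d.snd - z d.fst) ^ 2 := by
        refine Finset.sum_sq_le_sum_mul_sum_of_sq_le_mul _ (fun d _ => hinv d)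
          (fun d _ => mul_nonneg (hnn _ _) (sq_nonneg _)) fun d _ => ?_
        have := (hG _ _ d.adj).ne'
        rw [← mul_assoc, one_div_mul_cancel this, one_mul]
    _ ≤ _ := mul_le_mul hcost henergy
        (Finset.sum_nonneg fun d _ => mul_nonneg (hnn _ _) (sq_nonneg _))
        ((Finset.sum_nonneg fun d _ => hinv d).trans hcost)

/-- Popoviciu's inequality: the sum of squares of a zero-sum vector with entries in `[a, b]`. -/
theorem sum_sq_le_card_mul_sq_sub_div_four {V : Type*} [Fintype V] (z : V → ℝ)
    (hz : ∑ i, z i = 0) (a b : ℝ) (ha : ∀ i, a ≤ z i) (hb : ∀ i, z i ≤ b) :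
    ∑ i, z i ^ 2 ≤ Fintype.card V * ((b - a) ^ 2 / 4) := by
  have h : ∀ i, z i ^ 2 ≤ (a + b) * z i + (b - a) ^ 2 / 4 - ((a + b) / 2) ^ 2 := fun i => by
    nlinarith [mul_nonneg (sub_nonneg.2 (ha i)) (sub_nonneg.2 (hb i))]
  calc ∑ i, z i ^ 2 ≤ ∑ i, ((a + b) * z i + (b - a) ^ 2 / 4) :=
        Finset.sum_le_sum fun i _ => (h i).trans (sub_le_self _ (sq_nonneg _))
    _ = _ := by simp [Finset.sum_add_distrib, ← Finset.mul_sum, hz]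

/-- Diameter bound on the algebraic connectivity: if every pair of vertices is joined by
a path of positive weights along which the sum of reciprocal weights is at most `D`
(weighted diameter bound), then the weighted Laplacian quadratic form on zero-sum
vectors is at least `1/(nD)` times the squared norm, i.e. `λ₂ ≥ 1/(n d_w)`. -/
theorem weighted_diameter_algebraic_connectivity_bound
    {V : Type*} [Fintype V] [DecidableEq V]
    (hn : 2 ≤ Fintype.card V)
    (w : V → V → ℝ) (hsym : ∀ i j, w i j = w j i) (hnn : ∀ i j, 0 ≤ w i j)
    (D : ℝ) (hD : 0 < D)
    (hpath : ∀ i j : V, ∃ r : ℕ, ∃ p : Fin (r + 1) → V,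
      p 0 = i ∧ p (Fin.last r) = j ∧
      (∀ s : Fin r, 0 < w (p s.castSucc) (p s.succ)) ∧
      (∑ s : Fin r, 1 / w (p s.castSucc) (p s.succ)) ≤ D) :
    ∀ z : V → ℝ, (∑ i, z i) = 0 →
      (1 / ((Fintype.card V : ℝ) * D)) * (∑ i, (z i) ^ 2) ≤
        (1 / 2) * ∑ i, ∑ j, w i j * (z i - z j) ^ 2 := by
  intro z hz
  have : Nonempty V := Fintype.card_pos_iff.1 (by omega)
  obtain ⟨a, ha⟩ := Finite.exists_min z
  obtain ⟨b, hb⟩ := Finite.exists_max z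
  let G : SimpleGraph V :=
    { Adj := fun i j => i ≠ j ∧ 0 < w i j
      symm := ⟨fun i j h => ⟨h.1.symm, hsym i j ▸ h.2⟩⟩
      loopless := ⟨fun i h => h.1 rfl⟩ }
  obtain ⟨r, p, rfl, rfl, hpos, hcost⟩ := hpath a b
  obtain ⟨W, hW⟩ := G.exists_walk_sum_darts_le (fun i j => 1 / w i j)
    (fun i j => one_div_nonneg.2 (hnn i j)) r p fun s hs => ⟨hs, hpos s⟩
  have hE : 0 ≤ ∑ i, ∑ j, w i j * (z i - z j) ^ 2 :=
    Finset.sum_nonneg fun i _ => Finset.sum_nonneg fun j _ => mul_nonneg (hnn i j) (sq_nonneg _)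
  have hdiff := (W.sq_sub_le_sum_darts_mul w hnn (fun i j (h : i ≠ j ∧ 0 < w i j) => h.2) z).trans
    (mul_le_mul_of_nonneg_right (hW.trans hcost) hE)
  have hcard : (0 : ℝ) < Fintype.card V := Nat.cast_pos.2 Fintype.card_pos
  rw [one_div_mul_eq_div, div_le_iff₀ (mul_pos hcard hD)]
  calc ∑ i, z i ^ 2 ≤ Fintype.card V * ((z (p (Fin.last r)) - z (p 0)) ^ 2 / 4) :=
        sum_sq_le_card_mul_sq_sub_div_four z hz _ _ ha hb
    _ ≤ Fintype.card V * (1 / 2 * (D * ∑ i, ∑ j, w i j * (z i - z j) ^ 2)) := by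
        gcongr
        linarith [mul_nonneg hD.le hE]
    _ = _ := by ring
end

section
/- Let V be a finite set of n ≥ 2 vertices and w : V × V → ℝ a symmetric weight function such that every nonzero weight satisfies w(i,j) ≥ σ for some σ > 0. Suppose d ≥ 1 is such that every pair of vertices i, j is joined by a path of at most d steps along which all consecutive weights are nonzero (a bound on the graph diameter). Then for every z : V → ℝ with Σ_{i ∈ V} z_i = 0, (1/2) Σ_{i,j ∈ V} w(i,j)(z_i − z_j)² ≥ (4σ/(n d)) · Σ_{i ∈ V} z_i². (The algebraic connectivity satisfies λ₂ ≥ 4 min_e σ_{min,e} / (n d_G), where d_G is the graph diameter.) -/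
open Finset Real

/-- If consecutive values of a finite sequence are equal or adjacent, then its endpoints are
joined by a walk no longer than the sequence. -/
lemma SimpleGraph.exists_walk_length_le_of_seq {V : Type*} {G : SimpleGraph V} {r : ℕ}
    (p : Fin (r + 1) → V)
    (hp : ∀ s : Fin r, p s.castSucc = p s.succ ∨ G.Adj (p s.castSucc) (p s.succ)) :
    ∃ q : G.Walk (p 0) (p (Fin.last r)), q.length ≤ r := by
  have key : ∀ s : Fin (r + 1), ∃ q : G.Walk (p 0) (p s), q.length ≤ s := by
    intro s
    induction s using Fin.induction with
    | zero => exact ⟨.nil, by simp⟩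
    | succ s ih =>
      obtain ⟨q, hq⟩ := ih
      rcases hp s with h | h
      · exact ⟨q.copy rfl h, by simpa using hq.trans (Nat.le_succ _)⟩
      · exact ⟨q.concat h, by simpa [SimpleGraph.Walk.length_concat] using hq⟩
  simpa using key (Fin.last r)

/-- The endpoints `u`, `v` of a shortest path have squared difference at most the path length
times the sum of squared differences along the adjacent pairs `(a, b)` that separate `u` from
`v`, in the sense that `u` is closer to `a` and `v` is closer to `b`. -/
lemma SimpleGraph.sq_sub_le_dist_mul_sum {V : Type*} [Fintype V] (G : SimpleGraph V)
    [DecidableRel G.Adj] (z : V → ℝ) {u v : V} (huv : G.Reachable u v) :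
    (z u - z v) ^ 2 ≤ G.dist u v * ∑ e : V × V,
      if G.Adj e.1 e.2 ∧ G.dist u e.1 < G.dist u e.2 ∧ G.dist v e.2 < G.dist v e.1
      then (z e.1 - z e.2) ^ 2 else 0 := by
  classical
  obtain ⟨q, hq⟩ := huv.exists_walk_length_eq_dist
  set k := G.dist u v with hk
  have hleft (s : ℕ) (hs : s ≤ k) : G.dist u (q.getVert s) ≤ s :=
    (SimpleGraph.dist_le (q.take s)).trans (by simp [SimpleGraph.Walk.take_length])
  have hright (s : ℕ) (hs : s ≤ k) : G.dist (q.getVert s) v ≤ k - s :=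
    (SimpleGraph.dist_le (q.drop s)).trans (by simp [SimpleGraph.Walk.drop_length, hq])
  have htri (s : ℕ) : k ≤ G.dist u (q.getVert s) + G.dist (q.getVert s) v :=
    (SimpleGraph.Reachable.dist_triangle_left (q.take s).reachable v)
  have hu (s : ℕ) (hs : s ≤ k) : G.dist u (q.getVert s) = s := by
    have := hleft s hs; have := hright s hs; have := htri s; omega
  have hv (s : ℕ) (hs : s ≤ k) : G.dist v (q.getVert s) = k - s := by
    rw [SimpleGraph.dist_comm]
    have := hleft s hs; have := hright s hs; have := htri s; omega
  have htel : z u - z v = ∑ s ∈ range k, (z (q.getVert s) - z (q.getVert (s + 1))) := by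
    rw [Finset.sum_range_sub' (fun s => z (q.getVert s)), ← hq]
    simp
  have hcs := sq_sum_le_card_mul_sum_sq (s := range k)
    (f := fun s => z (q.getVert s) - z (q.getVert (s + 1)))
  rw [← htel, card_range] at hcs
  refine hcs.trans (mul_le_mul_of_nonneg_left ?_ (Nat.cast_nonneg _))
  rw [← Finset.sum_filter]
  have hinj : Set.InjOn (fun s => (q.getVert s, q.getVert (s + 1))) (range k : Set ℕ) := by
    intro s hs t ht hst
    have hs' := hu s (by simpa using (mem_range.mp hs).le)
    have ht' := hu t (by simpa using (mem_range.mp ht).le)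
    rw [← hs', ← ht']
    exact congrArg (fun e : V × V => G.dist u e.1) hst
  rw [← Finset.sum_image (f := fun e : V × V => (z e.1 - z e.2) ^ 2) hinj]
  refine Finset.sum_le_sum_of_subset_of_nonneg ?_ fun _ _ _ => sq_nonneg _
  intro e he
  obtain ⟨s, hs, rfl⟩ := mem_image.mp he
  have hs := mem_range.mp hs
  simp only [mem_filter, mem_univ, true_and]
  refine ⟨q.adj_getVert_succ (by omega), ?_, ?_⟩
  · rw [hu s hs.le, hu (s + 1) hs]; omega
  · rw [hv s hs.le, hv (s + 1) hs]; omega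

/-- Two disjoint subsets of a finite type have at most `n² / 4` pairs between them. -/
lemma Disjoint.four_mul_card_mul_card_le {V : Type*} [Fintype V] {A B : Finset V}
    (h : Disjoint A B) :
    4 * ((#A : ℝ) * #B) ≤ (Fintype.card V : ℝ) ^ 2 := by
  classical
  have hcard : #A + #B ≤ Fintype.card V := by
    rw [← card_union_of_disjoint h]
    exact card_le_univ _
  have hcard' : (#A : ℝ) + #B ≤ Fintype.card V := mod_cast hcard
  calc 4 * ((#A : ℝ) * #B) ≤ ((#A : ℝ) + #B) ^ 2 := by nlinarith [sq_nonneg ((#A : ℝ) - #B)]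
    _ ≤ _ := by gcongr

/-- For a zero-sum vector, the squared differences over all ordered pairs add up to `2n` times
the squared norm. -/
lemma sum_sum_sq_sub_of_sum_eq_zero {V : Type*} [Fintype V] {z : V → ℝ}
    (hz : ∑ i, z i = 0) :
    ∑ i, ∑ j, (z i - z j) ^ 2 = 2 * Fintype.card V * ∑ i, z i ^ 2 := by
  simp only [sub_sq, sum_add_distrib, sum_sub_distrib, ← mul_sum, hz, sum_const, card_univ,
    nsmul_eq_mul]
  simp
  ring

/-- In a graph of diameter at most `d`, the squared norm of a zero-sum vector is at most
`nd / 8` times the sum of squared differences over ordered pairs of adjacent vertices. -/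
lemma SimpleGraph.eight_mul_sum_sq_le {V : Type*} [Fintype V] (G : SimpleGraph V)
    [DecidableRel G.Adj] (hG : G.Preconnected) {d : ℕ} (hd : ∀ u v, G.dist u v ≤ d)
    {z : V → ℝ} (hz : ∑ i, z i = 0) :
    8 * ∑ i, z i ^ 2 ≤
      (Fintype.card V * d) * ∑ i, ∑ j, if G.Adj i j then (z i - z j) ^ 2 else 0 := by
  classical
  set n : ℝ := (Fintype.card V : ℝ) with hn
  rcases isEmpty_or_nonempty V with hV | hV
  · simp
  have hn0 : 0 < n := by rw [hn]; exact_mod_cast Fintype.card_pos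
  let A : V × V → Finset V := fun e => {u | G.dist u e.1 < G.dist u e.2}
  let B : V × V → Finset V := fun e => {v | G.dist v e.2 < G.dist v e.1}
  have hedge (e : V × V) : 4 * ∑ u, ∑ v,
      (if G.Adj e.1 e.2 ∧ G.dist u e.1 < G.dist u e.2 ∧ G.dist v e.2 < G.dist v e.1
        then (z e.1 - z e.2) ^ 2 else 0) ≤
      n ^ 2 * if G.Adj e.1 e.2 then (z e.1 - z e.2) ^ 2 else 0 := by
    by_cases he : G.Adj e.1 e.2
    · have hdisj : Disjoint (A e) (B e) := by
        rw [Finset.disjoint_left]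
        intro u hA hB
        simp only [A, B, mem_filter, mem_univ, true_and] at hA hB
        omega
      have hsum : ∑ u, ∑ v, (if G.dist u e.1 < G.dist u e.2 ∧ G.dist v e.2 < G.dist v e.1
          then (z e.1 - z e.2) ^ 2 else 0) = (#(A e) * #(B e)) * (z e.1 - z e.2) ^ 2 := by
        simp only [ite_and, A, B]
        rw [card_filter, card_filter]
        push_cast
        rw [sum_mul_sum, sum_mul]
        refine sum_congr rfl fun u _ => ?_
        rw [sum_mul]
        refine sum_congr rfl fun v _ => ?_
        split_ifs <;> simp
      simp only [he, true_and, if_true, hsum]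
      rw [← mul_assoc]
      exact mul_le_mul_of_nonneg_right hdisj.four_mul_card_mul_card_le (sq_nonneg _)
    · simp [he]
  have hpair (u v : V) : (z u - z v) ^ 2 ≤ d * ∑ e : V × V,
      if G.Adj e.1 e.2 ∧ G.dist u e.1 < G.dist u e.2 ∧ G.dist v e.2 < G.dist v e.1
      then (z e.1 - z e.2) ^ 2 else 0 := by
    refine (G.sq_sub_le_dist_mul_sum z (hG u v)).trans
      (mul_le_mul_of_nonneg_right (mod_cast hd u v) (sum_nonneg fun e _ => ?_))
    split_ifs <;> positivity
  have hmain : n * (8 * ∑ i, z i ^ 2) ≤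
      n * ((n * d) * ∑ i, ∑ j, if G.Adj i j then (z i - z j) ^ 2 else 0) := by
    calc n * (8 * ∑ i, z i ^ 2) = 4 * ∑ u, ∑ v, (z u - z v) ^ 2 := by
          rw [sum_sum_sq_sub_of_sum_eq_zero hz]; ring
      _ ≤ 4 * ∑ u, ∑ v, d * ∑ e : V × V,
          (if G.Adj e.1 e.2 ∧ G.dist u e.1 < G.dist u e.2 ∧ G.dist v e.2 < G.dist v e.1
            then (z e.1 - z e.2) ^ 2 else 0) := by
          gcongr with u _ v _
          exact hpair u v
      _ = d * ∑ e : V × V, 4 * ∑ u, ∑ v,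
          (if G.Adj e.1 e.2 ∧ G.dist u e.1 < G.dist u e.2 ∧ G.dist v e.2 < G.dist v e.1
            then (z e.1 - z e.2) ^ 2 else 0) := by
          simp only [← mul_sum]
          rw [mul_left_comm]
          congr 2
          rw [sum_comm (s := (univ : Finset (V × V)))]
          exact sum_congr rfl fun u _ => sum_comm
      _ ≤ d * ∑ e : V × V, n ^ 2 * if G.Adj e.1 e.2 then (z e.1 - z e.2) ^ 2 else 0 := by
          exact mul_le_mul_of_nonneg_left (sum_le_sum fun e _ => hedge e) (Nat.cast_nonneg d)
      _ = _ := by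
          rw [← mul_sum, Fintype.sum_prod_type]
          ring
  exact le_of_mul_le_mul_left hmain hn0

/-- Mohar-type bound on the algebraic connectivity: if every nonzero weight is at least
`σ > 0` and every pair of vertices is joined by a path of at most `d` steps with nonzero
weights, then the weighted Laplacian quadratic form on zero-sum vectors is at least
`4σ/(nd)` times the squared norm, i.e. `λ₂ ≥ 4 min_e σ_{min,e} / (n d_G)`. -/
theorem graph_diameter_algebraic_connectivity_bound
    {V : Type*} [Fintype V] [DecidableEq V]
    (hn : 2 ≤ Fintype.card V)
    (w : V → V → ℝ) (hsym : ∀ i j, w i j = w j i)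
    (σ : ℝ) (hσ : 0 < σ) (hmin : ∀ i j, w i j ≠ 0 → σ ≤ w i j)
    (d : ℕ) (hd : 1 ≤ d)
    (hpath : ∀ i j : V, ∃ r : ℕ, r ≤ d ∧ ∃ p : Fin (r + 1) → V,
      p 0 = i ∧ p (Fin.last r) = j ∧
      ∀ s : Fin r, w (p s.castSucc) (p s.succ) ≠ 0) :
    ∀ z : V → ℝ, (∑ i, z i) = 0 →
      (4 * σ / ((Fintype.card V : ℝ) * d)) * (∑ i, (z i) ^ 2) ≤
        (1 / 2) * ∑ i, ∑ j, w i j * (z i - z j) ^ 2 := by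
  classical
  intro z hz
  let G : SimpleGraph V :=
    { Adj := fun i j => i ≠ j ∧ w i j ≠ 0
      symm := ⟨fun i j h => ⟨h.1.symm, hsym i j ▸ h.2⟩⟩
      loopless := ⟨fun i h => h.1 rfl⟩ }
  have hwalk (i j : V) : ∃ q : G.Walk i j, q.length ≤ d := by
    obtain ⟨r, hr, p, rfl, rfl, hp⟩ := hpath i j
    obtain ⟨q, hq⟩ := SimpleGraph.exists_walk_length_le_of_seq (G := G) p fun s =>
      (eq_or_ne _ _).imp_right fun hne => ⟨hne, hp s⟩
    exact ⟨q, hq.trans hr⟩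
  have hbound := G.eight_mul_sum_sq_le (fun i j => (hwalk i j).elim fun q _ => q.reachable)
    (fun i j => (hwalk i j).elim fun q hq => (SimpleGraph.dist_le q).trans hq) hz
  have hweight : σ * ∑ i, ∑ j, (if G.Adj i j then (z i - z j) ^ 2 else 0) ≤
      ∑ i, ∑ j, w i j * (z i - z j) ^ 2 := by
    simp only [mul_sum]
    refine sum_le_sum fun i _ => sum_le_sum fun j _ => ?_
    split_ifs with h
    · exact mul_le_mul_of_nonneg_right (hmin i j h.2) (sq_nonneg _)
    · have hw : 0 ≤ w i j := by
        by_cases h0 : w i j = 0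
        · exact h0.ge
        · exact hσ.le.trans (hmin i j h0)
      rw [mul_zero]
      positivity
  have hnd : 0 < (Fintype.card V : ℝ) * d := by
    have : 0 < Fintype.card V * d := Nat.mul_pos (by omega) (by omega)
    exact_mod_cast this
  rw [div_mul_eq_mul_div, div_le_iff₀ hnd]
  have h₁ := mul_le_mul_of_nonneg_left hbound hσ.le
  have h₂ := mul_le_mul_of_nonneg_left hweight hnd.le
  linarith
end

section
/- Let n ≥ 1 be an integer, k ∈ ℤ, φ ∈ ℝ, and define the splay state θ_i = 2πki/n for i ∈ ℤ. Then for every i, −sin(θ_i − θ_{i−1} − φ) − sin(θ_i − θ_{i+1} − φ) − 2 sin(φ) = −2 sin(φ)(1 − cos(2πk/n)). Hence the splay state is a frequency-synchronized state of the Kuramoto–Sakaguchi model on the cycle of n oscillators with zero natural frequencies and unit couplings, with common frequency −2 sin(φ)(1 − cos(2πk/n)); in particular it is an equilibrium only when sin(φ)(1 − cos(2πk/n)) = 0. (For n = 6, k = 1 this recovers the common frequency −sin(φ).) -/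
open Real

/-- The splay state `θ_i = 2πki/n` is a frequency-synchronized state of the
Kuramoto–Sakaguchi model on a cycle of `n` oscillators with zero natural frequencies and
unit couplings: each instantaneous frequency equals `−2 sin(φ)(1 − cos(2πk/n))`,
independently of `i`. In particular it is an equilibrium only when
`sin(φ)(1 − cos(2πk/n)) = 0`. -/
theorem splay_state_synchronous_frequency
    (n : ℕ) (hn : 1 ≤ n) (k : ℤ) (φ : ℝ)
    (θ : ℤ → ℝ) (hθ : ∀ i : ℤ, θ i = 2 * π * (k : ℝ) * (i : ℝ) / (n : ℝ)) :
    ∀ i : ℤ,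
      -Real.sin (θ i - θ (i - 1) - φ) - Real.sin (θ i - θ (i + 1) - φ) - 2 * Real.sin φ
        = -2 * Real.sin φ * (1 - Real.cos (2 * π * (k : ℝ) / (n : ℝ))) := by
  intro i
  have hprev : θ i - θ (i - 1) - φ = 2 * π * (k : ℝ) / (n : ℝ) - φ := by
    rw [hθ, hθ]
    push_cast
    ring
  have hnext : θ i - θ (i + 1) - φ = -(2 * π * (k : ℝ) / (n : ℝ) + φ) := by
    rw [hθ, hθ]
    push_cast
    ring
  rw [hprev, hnext, Real.sin_neg, Real.sin_sub, Real.sin_add]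
  ring
end
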